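/- Let n ≥ 1, let ψ ∈ ℂ^d be a unit vector, let X̃, Z̃ : (Fin n → ZMod 2) → (observables on ℂ^d) be exactly linear families, and let Z̄ : (Fin n → ZMod 2) → (observables on ℂ^d) be a family such that every Z̄(c) commutes with every X̃(a) and every Z̃(b). Let ε_s, ε_a ≥ 0 and assume: (i) 2^{−n} ∑_c ‖(Z̃(c) − Z̄(c)) ψ‖² ≤ ε_s; (ii) the average of ‖(X̃(a) Z̃(c) + Z̃(c) X̃(a)) ψ‖² over the uniform distribution on the set of pairs {(a, c) : a·c = 1} is at most ε_a. Then the average of ‖(X̃(a) Z̃(b) − Z̃(b) X̃(a)) ψ‖² over the uniform distribution on the set of pairs {(a, b) : a·b = 0} is at most 100·(ε_s + ε_a); that is, X̃(a) and Z̃(b) approximately commute on ψ for typical pairs with a·b = 0. -/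

import Mathlib

open Matrix BigOperators
open scoped ComplexOrder Kronecker

noncomputable section

/-- Apply a matrix to a vector of the Euclidean space `ℂ^ι`. -/
def mApp {ι : Type*} [Fintype ι] [DecidableEq ι] (M : Matrix ι ι ℂ)
    (ψ : EuclideanSpace ℂ ι) : EuclideanSpace ℂ ι :=
  Matrix.toEuclideanLin M ψ

/-- An observable: a Hermitian matrix squaring to the identity. -/
def IsObservable {ι : Type*} [Fintype ι] [DecidableEq ι] (A : Matrix ι ι ℂ) : Prop :=
  A.IsHermitian ∧ A * A = 1

/-- The character `χ : ZMod 2 → ℂ` with `χ(0) = 1`, `χ(1) = -1`. -/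
def chi (x : ZMod 2) : ℂ := if x = 0 then 1 else -1

/-- The mod-2 dot product `a·b = ∑ i, a i * b i`. -/
def dotp {n : ℕ} (a b : Fin n → ZMod 2) : ZMod 2 := ∑ i, a i * b i

/-- A matrix-valued family indexed by `Fin n → ZMod 2` is exactly linear if
`F(a+b) = F(a) F(b)` for all `a, b`. -/
def ExactlyLinear {ι : Type*} [Fintype ι] [DecidableEq ι] {n : ℕ}
    (F : (Fin n → ZMod 2) → Matrix ι ι ℂ) : Prop :=
  ∀ a b, F (a + b) = F a * F b

lemma mApp_mul {d : ℕ} (M N : Matrix (Fin d) (Fin d) ℂ) (v : EuclideanSpace ℂ (Fin d)) :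
    mApp (M * N) v = mApp M (mApp N v) := by
  simp [mApp, Matrix.toEuclideanLin, Matrix.toLpLin_apply, Matrix.mulVec_mulVec]

lemma mApp_add {d : ℕ} (M N : Matrix (Fin d) (Fin d) ℂ) (v : EuclideanSpace ℂ (Fin d)) :
    mApp (M + N) v = mApp M v + mApp N v := by
  simp [mApp]

lemma mApp_sub {d : ℕ} (M N : Matrix (Fin d) (Fin d) ℂ) (v : EuclideanSpace ℂ (Fin d)) :
    mApp (M - N) v = mApp M v - mApp N v := by
  simp [mApp]

lemma mApp_one {d : ℕ} (v : EuclideanSpace ℂ (Fin d)) :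
    mApp (1 : Matrix (Fin d) (Fin d) ℂ) v = v := by
  simp [mApp, Matrix.toEuclideanLin, Matrix.toLpLin_apply]

lemma norm_mApp {d : ℕ} {U : Matrix (Fin d) (Fin d) ℂ} (hU : IsObservable U)
    (v : EuclideanSpace ℂ (Fin d)) : ‖mApp U v‖ = ‖v‖ := by
  have h : inner ℂ (mApp U v) (mApp U v) = inner ℂ v v := by
    have hs := Matrix.isSymmetric_toEuclideanLin_iff.mpr hU.1
    have h1 : inner ℂ (mApp U v) (mApp U v) = inner ℂ v (mApp U (mApp U v)) := hs _ _
    rw [h1, ← mApp_mul, hU.2, mApp_one]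
  rw [@norm_eq_sqrt_re_inner ℂ, @norm_eq_sqrt_re_inner ℂ _ _ _ _ v, h]

lemma key_bound {d : ℕ} (ψ : EuclideanSpace ℂ (Fin d))
    (X Y C B : Matrix (Fin d) (Fin d) ℂ) (hX : IsObservable X) (hY : IsObservable Y)
    (hB : IsObservable B) (hBX : B * X = X * B) (hBY : B * Y = Y * B) :
    ‖mApp (X * (Y * C) - (Y * C) * X) ψ‖ ^ 2 ≤
      8 * ‖mApp (C - B) ψ‖ ^ 2 + 4 * ‖mApp (X * Y + Y * X) ψ‖ ^ 2
        + 4 * ‖mApp (X * C + C * X) ψ‖ ^ 2 := by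
  have e : X * (Y * C) - (Y * C) * X = X * (Y * (C - B)) + B * (X * Y + Y * X)
      + Y * (X * (C - B)) - Y * (X * C + C * X) := by
    have h1 : B * (X * Y) = X * (Y * B) := by
      rw [← mul_assoc, hBX, mul_assoc, hBY]
    have h2 : B * (Y * X) = Y * (X * B) := by
      rw [← mul_assoc, hBY, mul_assoc, hBX]
    simp only [mul_add, mul_sub, h1, h2, mul_assoc]
    abel
  rw [e, mApp_sub, mApp_add, mApp_add]
  have n1 : ‖mApp (X * (Y * (C - B))) ψ‖ = ‖mApp (C - B) ψ‖ := by
    rw [mApp_mul, norm_mApp hX, mApp_mul, norm_mApp hY]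
  have n2 : ‖mApp (B * (X * Y + Y * X)) ψ‖ = ‖mApp (X * Y + Y * X) ψ‖ := by
    rw [mApp_mul, norm_mApp hB]
  have n3 : ‖mApp (Y * (X * (C - B))) ψ‖ = ‖mApp (C - B) ψ‖ := by
    rw [mApp_mul, norm_mApp hY, mApp_mul, norm_mApp hX]
  have n4 : ‖mApp (Y * (X * C + C * X)) ψ‖ = ‖mApp (X * C + C * X) ψ‖ := by
    rw [mApp_mul, norm_mApp hY]
  have t := (norm_sub_le (mApp (X * (Y * (C - B))) ψ + mApp (B * (X * Y + Y * X)) ψ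
      + mApp (Y * (X * (C - B))) ψ) (mApp (Y * (X * C + C * X)) ψ)).trans
    (add_le_add_left (norm_add₃_le) _)
  rw [n1, n2, n3, n4] at t
  generalize ‖mApp (C - B) ψ‖ = s at *
  generalize ‖mApp (X * Y + Y * X) ψ‖ = p at *
  generalize ‖mApp (X * C + C * X) ψ‖ = q at *
  refine (pow_le_pow_left₀ (norm_nonneg _) t 2).trans ?_
  nlinarith [sq_nonneg (s - p), sq_nonneg (s - q), sq_nonneg (p - q)]

abbrev VV (n : ℕ) := Fin n → ZMod 2

def HH {n : ℕ} (a : VV n) (t : ZMod 2) : Finset (VV n) :=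
  Finset.univ.filter (fun b => dotp a b = t)

lemma mem_HH {n : ℕ} {a b : VV n} {t : ZMod 2} : b ∈ HH a t ↔ dotp a b = t := by
  simp [HH]

lemma dotp_add {n : ℕ} (a b c : VV n) : dotp a (b + c) = dotp a b + dotp a c := by
  simp [dotp, mul_add, Finset.sum_add_distrib]

lemma VV_add_self {n : ℕ} (c : VV n) : c + c = 0 := by
  funext i
  exact CharTwo.add_self_eq_zero (c i)

lemma sum_shift {n : ℕ} (a c : VV n) (hc : dotp a c = 1) (g : VV n → ℝ) :
    ∑ b ∈ HH a 0, g (b + c) = ∑ b ∈ HH a 1, g b := by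
  refine Finset.sum_bij' (fun b _ => b + c) (fun b _ => b + c) ?_ ?_ ?_ ?_ ?_
  · intro b hb
    rw [mem_HH] at *
    rw [dotp_add, hb, hc, zero_add]
  · intro b hb
    rw [mem_HH] at *
    rw [dotp_add, hb, hc]; rfl
  · intro b _; rw [add_assoc, VV_add_self, add_zero]
  · intro b _; rw [add_assoc, VV_add_self, add_zero]
  · intro b _; rfl

lemma card_eq {n : ℕ} (a c : VV n) (hc : dotp a c = 1) :
    ((HH a 0).card : ℝ) = (HH a 1).card := by
  have := sum_shift a c hc (fun _ => 1)
  simpa using this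

lemma card_le {n : ℕ} (a : VV n) : ((HH a 1).card : ℝ) ≤ (HH a 0).card := by
  rcases (HH a 1).eq_empty_or_nonempty with h | ⟨c, hc⟩
  · simp [h]
  · exact (card_eq a c (mem_HH.mp hc)).ge

lemma row_bound {n : ℕ} (a : VV n) (f A s : VV n → ℝ) (hA : ∀ c, 0 ≤ A c) (hs : ∀ c, 0 ≤ s c)
    (h0 : a = 0 → ∀ b, f b = 0)
    (h : ∀ b c, dotp a b = 0 → dotp a c = 1 → f b ≤ 8 * s c + 4 * A (b + c) + 4 * A c) :
    ∑ b ∈ HH a 0, f b ≤ 8 * ∑ c, s c + 8 * ∑ c ∈ HH a 1, A c := by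
  have hsub : ∑ c ∈ HH a 1, s c ≤ ∑ c, s c :=
    Finset.sum_le_sum_of_subset_of_nonneg (Finset.subset_univ _) (fun i _ _ => hs i)
  by_cases ha : a = 0
  · rw [Finset.sum_eq_zero (fun b _ => h0 ha b)]
    have := Finset.sum_nonneg (s := Finset.univ) (fun i _ => hs i)
    have := Finset.sum_nonneg (s := HH a 1) (fun i _ => hA i)
    positivity
  obtain ⟨i, hi⟩ := Function.ne_iff.mp ha
  have hi1 : a i = 1 := by
    have : ∀ x : ZMod 2, x ≠ 0 → x = 1 := by decide
    exact this _ hi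
  have hc0 : dotp a (Pi.single i 1) = 1 := by
    simp [dotp, Pi.single_apply, hi1]
  have hcard := card_eq a _ hc0
  have hpos : (0 : ℝ) < (HH a 1).card := by
    exact_mod_cast Finset.card_pos.mpr ⟨_, mem_HH.mpr hc0⟩
  have main : ∑ c ∈ HH a 1, ∑ b ∈ HH a 0, f b ≤
      ∑ c ∈ HH a 1, ∑ b ∈ HH a 0, (8 * s c + 4 * A (b + c) + 4 * A c) :=
    Finset.sum_le_sum fun c hc => Finset.sum_le_sum fun b hb =>
      h b c (mem_HH.mp hb) (mem_HH.mp hc)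
  have rhs : ∑ c ∈ HH a 1, ∑ b ∈ HH a 0, (8 * s c + 4 * A (b + c) + 4 * A c) =
      (HH a 1).card * (8 * ∑ c ∈ HH a 1, s c + 8 * ∑ c ∈ HH a 1, A c) := by
    have : ∀ c ∈ HH a 1, ∑ b ∈ HH a 0, (8 * s c + 4 * A (b + c) + 4 * A c) =
        (HH a 1).card * (8 * s c) + 4 * ∑ b ∈ HH a 1, A b + (HH a 1).card * (4 * A c) := by
      intro c hc
      rw [Finset.sum_add_distrib, Finset.sum_add_distrib,
        ← Finset.mul_sum (HH a 0) (fun b => A (b + c)), sum_shift a c (mem_HH.mp hc)]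
      simp [hcard]
    rw [Finset.sum_congr rfl this]
    simp only [Finset.sum_add_distrib, ← Finset.mul_sum, Finset.sum_const, nsmul_eq_mul]
    ring
  rw [rhs, Finset.sum_const, nsmul_eq_mul] at main
  have := le_of_mul_le_mul_left main hpos
  linarith

lemma sum_pairs {n : ℕ} (t : ZMod 2) (g : VV n → VV n → ℝ) :
    ∑ p ∈ Finset.univ.filter (fun p : VV n × VV n => dotp p.1 p.2 = t), g p.1 p.2
      = ∑ a, ∑ b ∈ HH a t, g a b := by
  simp only [HH, Finset.sum_filter]
  rw [Fintype.sum_prod_type]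

lemma card_pairs {n : ℕ} (t : ZMod 2) :
    ((Finset.univ.filter (fun p : VV n × VV n => dotp p.1 p.2 = t)).card : ℝ)
      = ∑ a : VV n, ((HH a t).card : ℝ) := by
  have := sum_pairs (n := n) t (fun _ _ => 1)
  simpa using this

lemma comb {n : ℕ} (f A : VV n → VV n → ℝ) (s : VV n → ℝ) (εs εa : ℝ)
    (hεs : 0 ≤ εs) (hεa : 0 ≤ εa)
    (hA : ∀ a c, 0 ≤ A a c) (hs : ∀ c, 0 ≤ s c) (h0 : ∀ b, f 0 b = 0)
    (h : ∀ a b c, dotp a b = 0 → dotp a c = 1 → f a b ≤ 8 * s c + 4 * A a (b + c) + 4 * A a c)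
    (hstab : ((2 : ℝ) ^ n)⁻¹ * ∑ c, s c ≤ εs)
    (hanti : ((Finset.univ.filter (fun p : VV n × VV n => dotp p.1 p.2 = 1)).card : ℝ)⁻¹ *
        ∑ p ∈ Finset.univ.filter (fun p : VV n × VV n => dotp p.1 p.2 = 1), A p.1 p.2 ≤ εa) :
    ((Finset.univ.filter (fun p : VV n × VV n => dotp p.1 p.2 = 0)).card : ℝ)⁻¹ *
        ∑ p ∈ Finset.univ.filter (fun p : VV n × VV n => dotp p.1 p.2 = 0), f p.1 p.2
      ≤ 100 * (εs + εa) := by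
  have hle : ((Finset.univ.filter (fun p : VV n × VV n => dotp p.1 p.2 = 1)).card : ℝ) ≤
      ((Finset.univ.filter (fun p : VV n × VV n => dotp p.1 p.2 = 0)).card : ℝ) := by
    rw [card_pairs, card_pairs]
    exact Finset.sum_le_sum fun a _ => card_le a
  have hsum : ((Finset.univ.filter (fun p : VV n × VV n => dotp p.1 p.2 = 0)).card : ℝ) +
      ((Finset.univ.filter (fun p : VV n × VV n => dotp p.1 p.2 = 1)).card : ℝ) =
      (2 : ℝ) ^ n * 2 ^ n := by
    have hd : ∀ x : ZMod 2, x = 1 ↔ ¬ x = 0 := by decide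
    simp only [hd]
    rw [← Nat.cast_add, Finset.card_filter_add_card_filter_not]
    simp [ZMod.card]
  have hSA : ∑ p ∈ Finset.univ.filter (fun p : VV n × VV n => dotp p.1 p.2 = 1), A p.1 p.2 ≤
      ((Finset.univ.filter (fun p : VV n × VV n => dotp p.1 p.2 = 1)).card : ℝ) * εa := by
    rcases (Finset.univ.filter (fun p : VV n × VV n => dotp p.1 p.2 = 1)).eq_empty_or_nonempty
      with he | hne
    · rw [he]; simp
    · have : (0 : ℝ) < (Finset.univ.filter (fun p : VV n × VV n => dotp p.1 p.2 = 1)).card := by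
        exact_mod_cast Finset.card_pos.mpr hne
      rwa [inv_mul_le_iff₀ this] at hanti
  have hN : (0 : ℝ) < 2 ^ n := by positivity
  rw [inv_mul_le_iff₀ hN] at hstab
  have hf : ∑ p ∈ Finset.univ.filter (fun p : VV n × VV n => dotp p.1 p.2 = 0), f p.1 p.2 ≤
      (2 : ℝ) ^ n * (8 * ∑ c, s c) +
      8 * ∑ p ∈ Finset.univ.filter (fun p : VV n × VV n => dotp p.1 p.2 = 1), A p.1 p.2 := by
    rw [sum_pairs, sum_pairs]
    refine (Finset.sum_le_sum fun a _ => row_bound a (f a) (A a) s (hA a) hs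
      (fun ha b => by rw [ha]; exact h0 b) (h a)).trans ?_
    rw [Finset.sum_add_distrib, ← Finset.mul_sum _ (fun a => ∑ c ∈ HH a 1, A a c)]
    simp [ZMod.card]
  generalize ((Finset.univ.filter (fun p : VV n × VV n => dotp p.1 p.2 = 0)).card : ℝ) = S0 at *
  generalize ((Finset.univ.filter (fun p : VV n × VV n => dotp p.1 p.2 = 1)).card : ℝ) = S1 at *
  have hNN : (0 : ℝ) < (2 : ℝ) ^ n * 2 ^ n := by positivity
  have hS0 : 0 < S0 := by linarith
  rw [inv_mul_le_iff₀ hS0]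
  have e1 : (2 : ℝ) ^ n * ∑ c, s c ≤ (2 * S0) * εs := by
    calc (2 : ℝ) ^ n * ∑ c, s c ≤ 2 ^ n * (2 ^ n * εs) := by gcongr
      _ = (2 ^ n * 2 ^ n) * εs := by ring
      _ ≤ (2 * S0) * εs := by exact mul_le_mul_of_nonneg_right (by linarith) hεs
  have e2 : S1 * εa ≤ S0 * εa := by gcongr
  have p1 : 0 ≤ S0 * εs := by positivity
  have p2 : 0 ≤ S0 * εa := by positivity
  nlinarith

/-- Approximate commutation on pairs with `a·b = 0`, derived from closeness of `Z̃` to the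
commuting family `Z̄` (stabilizer test) and approximate anticommutation of `X̃, Z̃` on pairs
with `a·c = 1` (anticommutation test). Averages over the sets `{(a,c) : a·c = 1}` and
`{(a,b) : a·b = 0}` are with respect to the uniform distribution. -/
theorem approx_commutation {d n : ℕ} (hn : 1 ≤ n)
    (ψ : EuclideanSpace ℂ (Fin d)) (hψ : ‖ψ‖ = 1)
    (Xt Zt Zb : (Fin n → ZMod 2) → Matrix (Fin d) (Fin d) ℂ)
    (hXobs : ∀ a, IsObservable (Xt a)) (hZobs : ∀ a, IsObservable (Zt a))
    (hZbobs : ∀ a, IsObservable (Zb a))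
    (hXlin : ExactlyLinear Xt) (hZlin : ExactlyLinear Zt)
    (hcommX : ∀ c a, Zb c * Xt a = Xt a * Zb c)
    (hcommZ : ∀ c b, Zb c * Zt b = Zt b * Zb c)
    (εs εa : ℝ) (hεs : 0 ≤ εs) (hεa : 0 ≤ εa)
    (hstab : ((2 : ℝ) ^ n)⁻¹ * ∑ c, ‖mApp (Zt c - Zb c) ψ‖ ^ 2 ≤ εs)
    (hanti : ((Finset.univ.filter
          (fun p : (Fin n → ZMod 2) × (Fin n → ZMod 2) => dotp p.1 p.2 = 1)).card : ℝ)⁻¹ *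
        ∑ p ∈ Finset.univ.filter
          (fun p : (Fin n → ZMod 2) × (Fin n → ZMod 2) => dotp p.1 p.2 = 1),
          ‖mApp (Xt p.1 * Zt p.2 + Zt p.2 * Xt p.1) ψ‖ ^ 2 ≤ εa) :
    ((Finset.univ.filter
        (fun p : (Fin n → ZMod 2) × (Fin n → ZMod 2) => dotp p.1 p.2 = 0)).card : ℝ)⁻¹ *
      ∑ p ∈ Finset.univ.filter
        (fun p : (Fin n → ZMod 2) × (Fin n → ZMod 2) => dotp p.1 p.2 = 0),
        ‖mApp (Xt p.1 * Zt p.2 - Zt p.2 * Xt p.1) ψ‖ ^ 2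
      ≤ 100 * (εs + εa) := by
  refine comb (fun a b => ‖mApp (Xt a * Zt b - Zt b * Xt a) ψ‖ ^ 2)
    (fun a c => ‖mApp (Xt a * Zt c + Zt c * Xt a) ψ‖ ^ 2)
    (fun c => ‖mApp (Zt c - Zb c) ψ‖ ^ 2) εs εa hεs hεa
    (fun _ _ => by positivity) (fun _ => by positivity) ?_ ?_ hstab hanti
  · intro b
    have h1 : Xt 0 = 1 := by
      have := hXlin 0 0
      rwa [add_zero, (hXobs 0).2] at this
    simp [h1, mApp]
  · intro a b c _ _
    have hb : Zt b = Zt (b + c) * Zt c := by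
      rw [← hZlin, add_assoc, VV_add_self, add_zero]
    have := key_bound ψ (Xt a) (Zt (b + c)) (Zt c) (Zb c) (hXobs a) (hZobs _) (hZbobs c)
      (hcommX c a) (hcommZ c _)
    rw [← hb] at this
    exact this
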